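/- Let d ≥ 1 and let b ≥ 2d² be a prime. There exists a constant c > 0 (depending only on b and d) such that for every w ∈ ℕ, with n = 2dw and CS_n the Chen–Skriganov point set of N = b^n points, the discrepancy function of CS_n satisfies | ∫_{[0,1)^d} D_{CS_n}(y) dy | ≤ c·b^{−n}; equivalently, the b-adic Haar coefficient μ_{jml}(D_{CS_n}) with j = (−1,…,−1), m = (0,…,0), l = (1,…,1) has absolute value at most c·b^{−n}. -/

import Mathlib

open MeasureTheory

/-- The map `Φ_n : 𝔽_b^n → [0,1)`, `Φ_n(a) = a_1 b^{-1} + … + a_n b^{-n}`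
(digits identified with `{0,…,b−1}`). -/
noncomputable def PhiMap (b : ℕ) {n : ℕ} (a : Fin n → ZMod b) : ℝ :=
  ∑ k : Fin n, ((a k).val : ℝ) / (b : ℝ) ^ ((k : ℕ) + 1)

/-- The Chen–Skriganov code `𝒞_n ⊆ 𝔽_b^{dn}`, `n = 2dw`: the codeword associated with a
polynomial `f ∈ 𝔽_b[z]`, `deg f < n`, has `i`-th block
`a_i(f) = ((∂^{λ−1} f(β_{i,ν}))_{λ=1}^w)_{ν=1}^{2d}` (Hasse derivatives), i.e. the entry
with (0-based) index `k` of `a_i(f)` is `(∂^{k mod w} f)(β_{i, k / w})`. -/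
def csCode (b d w : ℕ) (β : Fin d → ℕ → ZMod b) :
    Set (Fin d → Fin (2 * d * w) → ZMod b) :=
  {A | ∃ f : Polynomial (ZMod b), f.degree < ((2 * d * w : ℕ) : WithBot ℕ) ∧
    ∀ (i : Fin d) (k : Fin (2 * d * w)),
      A i k = Polynomial.eval (β i ((k : ℕ) / w)) (Polynomial.hasseDeriv ((k : ℕ) % w) f)}

/-- The discrepancy function of the Chen–Skriganov point set
`CS_n = Φ_n^d(𝒞_n) ⊆ [0,1)^d` of `N = b^n` points, `n = 2dw`:
`D(x) = (1/N) #{z ∈ CS_n : z ∈ [0,x)} − x_1⋯x_d`. -/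
noncomputable def csDisc (b d w : ℕ) (β : Fin d → ℕ → ZMod b) (x : Fin d → ℝ) : ℝ :=
  (Nat.card {A : Fin d → Fin (2 * d * w) → ZMod b //
      A ∈ csCode b d w β ∧ ∀ i, PhiMap b (A i) ∈ Set.Ico (0 : ℝ) (x i)} : ℝ) /
    (b : ℝ) ^ (2 * d * w) - ∏ i, x i

open Polynomial

/-- Hermite interpolation data (Hasse derivatives of order `< w` at the points `p i`) of
polynomials of degree less than `m`. -/
noncomputable def hermiteMap {F ι : Type*} [Field F] (p : ι → F) (w m : ℕ) :
    degreeLT F m →ₗ[F] ι → Fin w → F :=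
  LinearMap.pi fun i => LinearMap.pi fun l =>
    leval (p i) ∘ₗ hasseDeriv (l : ℕ) ∘ₗ (degreeLT F m).subtype

theorem hermiteMap_apply {F ι : Type*} [Field F] (p : ι → F) (w m : ℕ) (f : degreeLT F m)
    (i : ι) (l : Fin w) :
    hermiteMap p w m f i l = (hasseDeriv (l : ℕ) (f : F[X])).eval (p i) := rfl

theorem X_sub_C_pow_dvd_of_hasseDeriv_eval_eq_zero {F : Type*} [Field F] (f : F[X]) (a : F)
    (w : ℕ) (h : ∀ l < w, (hasseDeriv l f).eval a = 0) : (X - C a) ^ w ∣ f := by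
  rw [X_sub_C_pow_dvd_iff, ← taylor_apply, X_pow_dvd_iff]
  intro l hl
  rw [taylor_coeff, h l hl]

theorem hermiteMap_injective {F ι : Type*} [Field F] [Fintype ι] {p : ι → F}
    (hp : Function.Injective p) {w m : ℕ} (hm : m ≤ Fintype.card ι * w) :
    Function.Injective (hermiteMap p w m) := by
  rw [← LinearMap.ker_eq_bot, LinearMap.ker_eq_bot']
  intro f hf
  have hdvd : ∏ i, (X - C (p i)) ^ w ∣ (f : F[X]) := by
    refine Fintype.prod_dvd_of_coprime
      (fun i j hij => (pairwise_coprime_X_sub_C hp hij).pow) fun i => ?_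
    refine X_sub_C_pow_dvd_of_hasseDeriv_eval_eq_zero _ _ _ fun l hl => ?_
    exact congrFun (congrFun hf i) ⟨l, hl⟩
  refine Subtype.ext (eq_zero_of_dvd_of_degree_lt hdvd ?_)
  refine (mem_degreeLT.1 f.2).trans_le ?_
  have hdeg : (∏ i, (X - C (p i)) ^ w).degree = ((Fintype.card ι * w : ℕ) : WithBot ℕ) := by
    simp [degree_prod]
  rw [hdeg]
  exact_mod_cast hm

theorem hermiteMap_surjective {F ι : Type*} [Field F] [Fintype ι] {p : ι → F}
    (hp : Function.Injective p) {w m : ℕ} (hm : Fintype.card ι * w ≤ m) :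
    Function.Surjective (hermiteMap p w m) := by
  have hfin : Module.finrank F (degreeLT F (Fintype.card ι * w)) =
      Module.finrank F (ι → Fin w → F) := by
    rw [(degreeLTEquiv F _).finrank_eq]
    simp [Module.finrank_pi_fintype]
  have : Module.Finite F (degreeLT F (Fintype.card ι * w)) :=
    Module.Finite.equiv (degreeLTEquiv F _).symm
  intro v
  obtain ⟨f, hf⟩ := (LinearMap.injective_iff_surjective_of_finrank_eq_finrank hfin).1
    (hermiteMap_injective hp le_rfl) v
  exact ⟨⟨f, degreeLT_mono hm f.2⟩, hf⟩

/-- The average of `g ∘ T` over a finite group is the average of `g` when `T` is a surjective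
homomorphism. -/
theorem card_mul_sum_comp_of_surjective {V W : Type*} [AddGroup V] [AddGroup W] [Fintype V]
    [Fintype W] (T : V →+ W) (hT : Function.Surjective T) (g : W → ℝ) :
    (Fintype.card W : ℝ) * ∑ v, g (T v) = Fintype.card V * ∑ x, g x := by
  classical
  have hfib : ∀ x : W, ((Finset.univ.filter fun v => T v = x).card : ℝ) =
      (Finset.univ.filter fun v => T v = 0).card := fun x => by
    exact_mod_cast AddMonoidHom.card_fiber_eq_of_mem_range T (hT x) (hT 0)
  have key : ∀ k : W → ℝ, ∑ v, k (T v) =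
      (Finset.univ.filter fun v => T v = 0).card * ∑ x, k x := fun k => by
    rw [← Finset.sum_fiberwise Finset.univ T, Finset.mul_sum]
    refine Finset.sum_congr rfl fun x _ => ?_
    rw [Finset.sum_congr rfl (fun v hv => by rw [(Finset.mem_filter.1 hv).2]), Finset.sum_const,
      nsmul_eq_mul, hfib x]
  have hcard := key fun _ => 1
  simp only [Finset.sum_const, nsmul_eq_mul, mul_one, Finset.card_univ] at hcard
  rw [key g, hcard]
  ring

theorem PhiMap_nonneg (b : ℕ) {n : ℕ} (a : Fin n → ZMod b) : 0 ≤ PhiMap b a :=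
  Finset.sum_nonneg fun _ _ => by positivity

theorem sum_pred_div_pow (b n : ℕ) (hb : 0 < b) :
    ∑ k : Fin n, ((b : ℝ) - 1) / (b : ℝ) ^ ((k : ℕ) + 1) = 1 - ((b : ℝ) ^ n)⁻¹ := by
  have hb' : (b : ℝ) ≠ 0 := by positivity
  rw [Fin.sum_univ_eq_sum_range (fun k => ((b : ℝ) - 1) / (b : ℝ) ^ (k + 1))]
  induction n with
  | zero => simp
  | succ n ih =>
    rw [Finset.sum_range_succ, ih]
    field_simp
    ring

theorem PhiMap_le_one (b : ℕ) [NeZero b] {n : ℕ} (a : Fin n → ZMod b) : PhiMap b a ≤ 1 := by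
  have hpos : 0 < b := NeZero.pos b
  calc PhiMap b a ≤ ∑ k : Fin n, ((b : ℝ) - 1) / (b : ℝ) ^ ((k : ℕ) + 1) := by
        refine Finset.sum_le_sum fun k _ => ?_
        gcongr
        have h : (a k).val + 1 ≤ b := ZMod.val_lt (a k)
        have h' : ((a k).val : ℝ) + 1 ≤ b := by exact_mod_cast h
        linarith
    _ = 1 - ((b : ℝ) ^ n)⁻¹ := sum_pred_div_pow b n hpos
    _ ≤ 1 := by
        have : 0 ≤ ((b : ℝ) ^ n)⁻¹ := by positivity
        linarith

theorem sum_val_zmod (b : ℕ) [NeZero b] :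
    ∑ x : ZMod b, (x.val : ℝ) = b * ((b - 1) / 2) := by
  obtain ⟨m, rfl⟩ : ∃ m, b = m + 1 := Nat.exists_eq_succ_of_ne_zero (NeZero.ne b)
  change ∑ x : Fin (m + 1), ((x : ℕ) : ℝ) = _
  rw [Fin.sum_univ_eq_sum_range (fun k => (k : ℝ))]
  have h := Finset.sum_range_id_mul_two (m + 1)
  rw [Nat.add_sub_cancel] at h
  have h' : (∑ k ∈ Finset.range (m + 1), (k : ℝ)) * 2 = (m + 1) * m := by
    simpa using congrArg (Nat.cast : ℕ → ℝ) h
  push_cast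
  linarith

/-- If any choice of one digit from each block is jointly equidistributed, then the average of
`∏ i, (1 - z i)` over the point set is exactly `((1 + b⁻ⁿ) / 2) ^ d`. -/
theorem sum_prod_one_sub_PhiMap {b d n : ℕ} [NeZero b] (hn : 0 < n) {V : Type*} [AddGroup V]
    [Fintype V] (L : V →+ Fin d → Fin n → ZMod b)
    (hL : ∀ κ : Fin d → Fin n, ∀ v : Fin d → ZMod b, ∃ f, ∀ i, L f i (κ i) = v i) :
    ∑ f, ∏ i, (1 - PhiMap b (L f i)) =
      Fintype.card V * ((1 + ((b : ℝ) ^ n)⁻¹) / 2) ^ d := by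
  classical
  have hpos : 0 < b := NeZero.pos b
  have hb' : (b : ℝ) ≠ 0 := by positivity
  have hn' : (n : ℝ) ≠ 0 := by positivity
  let h : Fin n → ZMod b → ℝ := fun k x => 1 / n - (x.val : ℝ) / (b : ℝ) ^ ((k : ℕ) + 1)
  let μ : Fin n → ℝ := fun k => 1 / n - ((b : ℝ) - 1) / (b : ℝ) ^ ((k : ℕ) + 1) / 2
  have hh : ∀ a : Fin n → ZMod b, 1 - PhiMap b a = ∑ k, h k (a k) := fun a => by
    simp [h, PhiMap, Finset.sum_sub_distrib, hn']
  have hμ : ∀ k, ∑ x, h k x = b * μ k := fun k => by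
    simp only [h, μ, Finset.sum_sub_distrib, ← Finset.sum_div, sum_val_zmod]
    simp [ZMod.card]
    ring
  have hμs : ∑ k, μ k = (1 + ((b : ℝ) ^ n)⁻¹) / 2 := by
    simp only [μ, Finset.sum_sub_distrib, ← Finset.sum_div, sum_pred_div_pow b n hpos]
    simp [hn']
    ring
  have hκ : ∀ κ : Fin d → Fin n, ∑ f, ∏ i, h (κ i) (L f i (κ i)) =
      Fintype.card V * ∏ i, μ (κ i) := fun κ => by
    let T : V →+ (Fin d → ZMod b) :=
      { toFun := fun f i => L f i (κ i)
        map_zero' := by ext i; simp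
        map_add' := fun x y => by ext i; simp }
    have hT : Function.Surjective T := fun v => (hL κ v).imp fun f hf => funext hf
    have h1 := card_mul_sum_comp_of_surjective T hT fun x => ∏ i, h (κ i) (x i)
    rw [← Fintype.prod_sum fun i x => h (κ i) x] at h1
    simp only [hμ, Finset.prod_mul_distrib, Finset.prod_const, Fintype.card_pi, ZMod.card,
      Finset.card_univ, Fintype.card_fin, Nat.cast_pow] at h1
    have hbd : (b : ℝ) ^ d ≠ 0 := by positivity
    refine mul_left_cancel₀ hbd (h1.trans ?_)
    ring
  simp only [hh, Fintype.prod_sum]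
  rw [Finset.sum_comm]
  simp only [hκ, ← Finset.mul_sum]
  rw [← Fintype.prod_sum fun (_ : Fin d) k => μ k]
  rw [hμs, Finset.prod_const, Finset.card_univ, Fintype.card_fin]

theorem integral_indicator_Ioi {z : ℝ} (h0 : 0 ≤ z) (h1 : z ≤ 1) :
    ∫ y in Set.Ico (0 : ℝ) 1, (Set.Ioi z).indicator (fun _ => (1 : ℝ)) y = 1 - z := by
  rw [integral_indicator measurableSet_Ioi, Measure.restrict_restrict measurableSet_Ioi]
  have : Set.Ioi z ∩ Set.Ico 0 1 = Set.Ioo z 1 := by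
    ext y
    simp only [Set.mem_inter_iff, Set.mem_Ioi, Set.mem_Ico, Set.mem_Ioo]
    constructor
    · rintro ⟨h, _, h'⟩; exact ⟨h, h'⟩
    · rintro ⟨h, h'⟩; exact ⟨h, by linarith, h'⟩
  simp [this, h1]

theorem integral_Ico_id : ∫ y in Set.Ico (0 : ℝ) 1, y = 1 / 2 := by
  rw [integral_Ico_eq_integral_Ioc, ← intervalIntegral.integral_of_le zero_le_one]
  simp

theorem integral_csDisc (b d w : ℕ) [NeZero b] (β : Fin d → ℕ → ZMod b)
    (S : Finset (Fin d → Fin (2 * d * w) → ZMod b)) (hS : ∀ A, A ∈ S ↔ A ∈ csCode b d w β) :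
    ∫ y in Set.univ.pi (fun _ : Fin d => Set.Ico (0 : ℝ) 1), csDisc b d w β y =
      (∑ A ∈ S, ∏ i, (1 - PhiMap b (A i))) / (b : ℝ) ^ (2 * d * w) - (1 / 2) ^ d := by
  classical
  have hcount : ∀ y : Fin d → ℝ, csDisc b d w β y =
      (∑ A ∈ S, ∏ i, (Set.Ioi (PhiMap b (A i))).indicator (fun _ => (1 : ℝ)) (y i)) /
        (b : ℝ) ^ (2 * d * w) - ∏ i, y i := fun y => by
    unfold csDisc
    congr 2
    have hcard : Nat.card {A : Fin d → Fin (2 * d * w) → ZMod b //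
        A ∈ csCode b d w β ∧ ∀ i, PhiMap b (A i) ∈ Set.Ico (0 : ℝ) (y i)} =
        (S.filter fun A => ∀ i, PhiMap b (A i) < y i).card := by
      refine Nat.subtype_card _ fun A => ?_
      simp [hS, PhiMap_nonneg]
    rw [hcard, Finset.card_filter]
    push_cast
    refine Finset.sum_congr rfl fun A _ => ?_
    simp only [Set.indicator_apply, Set.mem_Ioi, Finset.prod_ite_zero]
    simp
  have hint : ∀ A : Fin d → Fin (2 * d * w) → ZMod b, Integrable
      (fun y : Fin d → ℝ => ∏ i, (Set.Ioi (PhiMap b (A i))).indicator (fun _ => (1 : ℝ)) (y i))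
      (Measure.pi fun _ : Fin d => volume.restrict (Set.Ico (0 : ℝ) 1)) := fun A =>
    Integrable.fintype_prod fun i => (integrable_const _).indicator measurableSet_Ioi
  have hid : Integrable (fun y : Fin d → ℝ => ∏ i, y i)
      (Measure.pi fun _ : Fin d => volume.restrict (Set.Ico (0 : ℝ) 1)) :=
    Integrable.fintype_prod (f := fun _ x => x) fun i =>
      (continuous_id.integrableOn_Icc (a := (0 : ℝ)) (b := 1)).mono_set Set.Ico_subset_Icc_self
  simp only [hcount]
  rw [volume_pi, Measure.restrict_pi_pi, integral_sub _ hid, integral_div,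
    integral_finsetSum _ fun A _ => hint A]
  · rw [integral_fintype_prod_eq_prod (fun (_ : Fin d) (x : ℝ) => x)]
    simp only [integral_Ico_id, Finset.prod_const, Finset.card_univ, Fintype.card_fin]
    congr 2
    refine Finset.sum_congr rfl fun A _ => ?_
    rw [integral_fintype_prod_eq_prod
      (fun i => (Set.Ioi (PhiMap b (A i))).indicator (fun _ => (1 : ℝ)))]
    exact Finset.prod_congr rfl fun i _ =>
      integral_indicator_Ioi (PhiMap_nonneg b _) (PhiMap_le_one b _)
  · exact (integrable_finsetSum _ fun A _ => hint A).div_const _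

/-- The encoding map of the Chen–Skriganov code. -/
noncomputable def csEncode (b d w : ℕ) [Fact b.Prime] (β : Fin d → ℕ → ZMod b) :
    degreeLT (ZMod b) (2 * d * w) →ₗ[ZMod b] Fin d → Fin (2 * d * w) → ZMod b :=
  LinearMap.pi fun i => LinearMap.pi fun k =>
    leval (β i ((k : ℕ) / w)) ∘ₗ hasseDeriv ((k : ℕ) % w) ∘ₗ
      (degreeLT (ZMod b) (2 * d * w)).subtype

theorem csEncode_apply (b d w : ℕ) [Fact b.Prime] (β : Fin d → ℕ → ZMod b)
    (f : degreeLT (ZMod b) (2 * d * w)) (i : Fin d) (k : Fin (2 * d * w)) :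
    csEncode b d w β f i k =
      (hasseDeriv ((k : ℕ) % w) (f : (ZMod b)[X])).eval (β i ((k : ℕ) / w)) := rfl

theorem mem_csCode_iff (b d w : ℕ) [Fact b.Prime] (β : Fin d → ℕ → ZMod b)
    (A : Fin d → Fin (2 * d * w) → ZMod b) :
    A ∈ csCode b d w β ↔ ∃ f, csEncode b d w β f = A := by
  constructor
  · rintro ⟨f, hf, hA⟩
    exact ⟨⟨f, mem_degreeLT.2 hf⟩, by ext i k; exact (hA i k).symm⟩
  · rintro ⟨f, rfl⟩
    exact ⟨f, mem_degreeLT.1 f.2, fun _ _ => rfl⟩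

theorem csEncode_injective {b d w : ℕ} [Fact b.Prime] (hd : 1 ≤ d) {β : Fin d → ℕ → ZMod b}
    (hβ : ∀ i₁ ν₁ i₂ ν₂, ν₁ < 2 * d → ν₂ < 2 * d → β i₁ ν₁ = β i₂ ν₂ →
      i₁ = i₂ ∧ ν₁ = ν₂) :
    Function.Injective (csEncode b d w β) := by
  have hp : Function.Injective fun ν : Fin (2 * d) => β ⟨0, hd⟩ ν := fun ν₁ ν₂ h =>
    Fin.ext (hβ _ _ _ _ ν₁.2 ν₂.2 h).2
  intro f g hfg
  refine hermiteMap_injective hp (w := w) (m := 2 * d * w) (by simp) ?_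
  ext ν l
  have hlt : (ν : ℕ) * w + l < 2 * d * w := by
    calc (ν : ℕ) * w + l < ν * w + w := by have := l.2; omega
      _ = (ν + 1) * w := by ring
      _ ≤ 2 * d * w := Nat.mul_le_mul_right _ ν.2
  have h := congrFun (congrFun hfg ⟨0, hd⟩) ⟨ν * w + l, hlt⟩
  have hmod : ((ν : ℕ) * w + l) % w = l := by
    rw [Nat.mul_comm, Nat.mul_add_mod, Nat.mod_eq_of_lt l.2]
  have hdiv : ((ν : ℕ) * w + l) / w = ν := by
    rw [Nat.mul_comm, Nat.mul_add_div l.pos, Nat.div_eq_of_lt l.2, add_zero]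
  simpa only [csEncode_apply, hermiteMap_apply, hmod, hdiv] using h

theorem csEncode_digits_surjective {b d w : ℕ} [Fact b.Prime] {β : Fin d → ℕ → ZMod b}
    (hβ : ∀ i₁ ν₁ i₂ ν₂, ν₁ < 2 * d → ν₂ < 2 * d → β i₁ ν₁ = β i₂ ν₂ →
      i₁ = i₂ ∧ ν₁ = ν₂) (hw : 0 < w) (κ : Fin d → Fin (2 * d * w)) (v : Fin d → ZMod b) :
    ∃ f, ∀ i, csEncode b d w β f i (κ i) = v i := by
  have hlt : ∀ i, (κ i : ℕ) / w < 2 * d := fun i => Nat.div_lt_of_lt_mul <|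
    (κ i).2.trans_eq (mul_comm _ _)
  have hp : Function.Injective fun i : Fin d => β i ((κ i : ℕ) / w) := fun i j h =>
    (hβ _ _ _ _ (hlt i) (hlt j) h).1
  obtain ⟨f, hf⟩ := hermiteMap_surjective hp (w := w) (m := 2 * d * w)
    (by rw [Fintype.card_fin]; exact Nat.mul_le_mul_right _ (by omega)) fun i _ => v i
  exact ⟨f, fun i => congrFun (congrFun hf i) ⟨(κ i : ℕ) % w, Nat.mod_lt _ hw⟩⟩

theorem abs_half_one_add_pow_sub_le (d : ℕ) {t : ℝ} (h0 : 0 ≤ t) (h1 : t ≤ 1) :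
    |((1 + t) / 2) ^ d - (1 / 2) ^ d| ≤ t := by
  have hle : (1 / 2 : ℝ) ^ d ≤ ((1 + t) / 2) ^ d := by gcongr; linarith
  rw [abs_of_nonneg (by linarith)]
  have hhalf : (1 / 2 : ℝ) ^ d ≤ 1 := pow_le_one₀ (by norm_num) (by norm_num)
  induction d with
  | zero => simpa using h0
  | succ d ih =>
    have hle' : (1 / 2 : ℝ) ^ d ≤ ((1 + t) / 2) ^ d := by gcongr; linarith
    have hhalf' : (1 / 2 : ℝ) ^ d ≤ 1 := pow_le_one₀ (by norm_num) (by norm_num)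
    have hone : ((1 + t) / 2) ^ d ≤ 1 := pow_le_one₀ (by linarith) (by linarith)
    have hih := ih hle' hhalf'
    rw [pow_succ, pow_succ]
    nlinarith [mul_le_mul_of_nonneg_left hone h0]

/-- `|∫_{[0,1)^d} D_{CS_n}(y) dy| ≤ c b^{−n}` for the Chen–Skriganov point
sets, with `c` depending only on `b` and `d` (equivalently: the `b`-adic Haar coefficient
with `j = (−1,…,−1)`, `m = (0,…,0)`, `l = (1,…,1)` is at most `c b^{−n}` in modulus). -/
theorem statement8 (b d : ℕ) (hd : 1 ≤ d) (hb : b.Prime) (hbd : 2 * d ^ 2 ≤ b)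
    (β : Fin d → ℕ → ZMod b)
    (hβ : ∀ i₁ ν₁ i₂ ν₂, ν₁ < 2 * d → ν₂ < 2 * d → β i₁ ν₁ = β i₂ ν₂ →
      i₁ = i₂ ∧ ν₁ = ν₂) :
    ∃ c > (0 : ℝ), ∀ w : ℕ, 1 ≤ w →
      |∫ y in Set.univ.pi (fun _ : Fin d => Set.Ico (0 : ℝ) 1), csDisc b d w β y|
        ≤ c * ((b : ℝ) ^ (2 * d * w))⁻¹ := by
  classical
  have : Fact b.Prime := ⟨hb⟩
  refine ⟨1, one_pos, fun w hw => ?_⟩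
  have hb1 : (1 : ℝ) ≤ b := by exact_mod_cast hb.one_le
  let e := (degreeLTEquiv (ZMod b) (2 * d * w)).toEquiv
  let _ : Fintype (degreeLT (ZMod b) (2 * d * w)) := Fintype.ofEquiv _ e.symm
  have hcard : Fintype.card (degreeLT (ZMod b) (2 * d * w)) = b ^ (2 * d * w) := by
    rw [Fintype.card_congr e]
    simp [ZMod.card]
  rw [integral_csDisc b d w β (Finset.univ.image (csEncode b d w β))
    (fun A => by simp [mem_csCode_iff]),
    Finset.sum_image fun f _ g _ h => csEncode_injective hd hβ h]
  have hsum := sum_prod_one_sub_PhiMap (by positivity) (csEncode b d w β).toAddMonoidHom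
    (csEncode_digits_surjective hβ hw)
  simp only [LinearMap.toAddMonoidHom_coe] at hsum
  rw [hsum, hcard, Nat.cast_pow, mul_div_cancel_left₀ _ (by positivity), one_mul]
  exact abs_half_one_add_pow_sub_le d (by positivity) (inv_le_one_of_one_le₀ (one_le_pow₀ hb1))
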